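/- (Remmert's proper mapping theorem for domains) Let U ⊆ ℂⁿ and V ⊆ ℂᵐ be open, let F : U → ℂᵐ be holomorphic, and let A be an analytic subset of U with F(A) ⊆ V. Assume the restriction of F to A, viewed as a map A → V, is proper (the preimage in A of every compact subset of V is compact). Then the image F(A) is an analytic subset of V. -/

import Mathlib

/-- `A` is an analytic subset of the open set `U ⊆ ℂⁿ`: it is contained in `U`, closed in `U`,
and every point of `A` has an open neighborhood `W ⊆ U` on which `A` is the common zero set of
finitely many holomorphic functions. -/
def IsAnalyticSubset {n : ℕ} (U A : Set (EuclideanSpace ℂ (Fin n))) : Prop :=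
  A ⊆ U ∧ (∀ z ∈ U, z ∈ closure A → z ∈ A) ∧
  ∀ a ∈ A, ∃ W : Set (EuclideanSpace ℂ (Fin n)), IsOpen W ∧ a ∈ W ∧ W ⊆ U ∧
    ∃ (k : ℕ) (f : Fin k → EuclideanSpace ℂ (Fin n) → ℂ),
      (∀ i, DifferentiableOn ℂ (f i) W) ∧
      A ∩ W = {z ∈ W | ∀ i, f i z = 0}

open Set Filter Topology Metric

/-- A holomorphic function on an open subset of `ℂⁿ` is continuously differentiable. -/
theorem continuousOn_fderiv_of_holomorphic {E : Type*} [NormedAddCommGroup E]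
    [NormedSpace ℂ E] [FiniteDimensional ℂ E] {f : E → ℂ} {Ω : Set E} (hΩ : IsOpen Ω)
    (hf : DifferentiableOn ℂ f Ω) : ContinuousOn (fderiv ℂ f) Ω := by
  have : ProperSpace E := FiniteDimensional.proper ℂ E
  intro p hp
  apply ContinuousAt.continuousWithinAt
  obtain ⟨r, hr, hrΩ⟩ := nhds_basis_closedBall.mem_iff.1 (hΩ.mem_nhds hp)
  have huc := (isCompact_closedBall p r).uniformContinuousOn_of_continuous
    (hf.continuousOn.mono hrΩ)
  rw [Metric.uniformContinuousOn_iff_le] at huc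
  rw [Metric.continuousAt_iff']
  intro ε hε
  have hr2 : 0 < r / 2 := by positivity
  obtain ⟨η, hη, hclose⟩ := huc (ε / 2 * (r / 2) / 2) (by positivity)
  filter_upwards [ball_mem_nhds p (lt_min hη hr2)] with y hy
  have hy1 : dist y p < η := lt_of_lt_of_le hy (min_le_left _ _)
  have hy2 : dist y p < r / 2 := lt_of_lt_of_le hy (min_le_right _ _)
  have hmem : ∀ x e : E, dist x p < r / 2 → e ∈ ball (0 : E) (r / 2) → x + e ∈ closedBall p r := by
    intro x e hx he
    rw [mem_ball_zero_iff] at he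
    rw [mem_closedBall, dist_eq_norm] at *
    calc ‖x + e - p‖ = ‖(x - p) + e‖ := by congr 1; abel
      _ ≤ ‖x - p‖ + ‖e‖ := norm_add_le _ _
      _ ≤ r := by linarith
  have hpp : dist p p < r / 2 := by simpa using hr2
  have hd : ∀ x : E, dist x p < r / 2 →
      DifferentiableOn ℂ (fun e => f (x + e)) (ball (0 : E) (r / 2)) := by
    intro x hx
    exact hf.comp (by fun_prop) fun e he => hrΩ (hmem x e hx he)
  have hd0 : ∀ x : E, dist x p < r / 2 → DifferentiableAt ℂ (fun e => f (x + e)) 0 := fun x hx =>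
    (hd x hx).differentiableAt (ball_mem_nhds _ hr2)
  have hkey : ‖fderiv ℂ (fun e => f (y + e) - f (p + e)) 0‖ ≤ (ε / 2 * (r / 2)) / (r / 2) := by
    refine Complex.norm_fderiv_le_div_of_mapsTo_ball ((hd y hy2).sub (hd p hpp)) ?_ hr2
    intro e he
    have h1 : ∀ e ∈ ball (0 : E) (r / 2), ‖f (y + e) - f (p + e)‖ ≤ ε / 2 * (r / 2) / 2 := by
      intro e he
      rw [← dist_eq_norm]
      refine hclose _ (hmem y e hy2 he) _ (hmem p e hpp he) ?_
      rw [dist_add_right]; exact hy1.le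
    rw [mem_closedBall, dist_eq_norm]
    refine (norm_sub_le _ _).trans ?_
    have := h1 e he
    have := h1 0 (mem_ball_self hr2)
    simp only at *
    linarith
  have heq : fderiv ℂ (fun e => f (y + e) - f (p + e)) 0 = fderiv ℂ f y - fderiv ℂ f p := by
    rw [fderiv_fun_sub (hd0 y hy2) (hd0 p hpp), fderiv_comp_add_left, fderiv_comp_add_left,
      add_zero, add_zero]
  rw [heq, mul_div_assoc, div_self hr2.ne', mul_one] at hkey
  rw [dist_eq_norm]
  linarith

/-- Circle integrals depend holomorphically on parameters. -/
theorem differentiableOn_circleIntegral_param {E : Type*} [NormedAddCommGroup E]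
    [NormedSpace ℂ E] [FiniteDimensional ℂ E] {H : ℂ × E → ℂ} {Ω : Set (ℂ × E)} (hΩ : IsOpen Ω)
    (hH : DifferentiableOn ℂ H Ω) {c : ℂ} {ρ : ℝ} {B : Set E}
    (hB : ∀ y ∈ B, ∀ θ : ℝ, (circleMap c ρ θ, y) ∈ Ω) :
    DifferentiableOn ℂ (fun y => ∮ t in C(c, ρ), H (t, y)) B := by
  have : ProperSpace E := FiniteDimensional.proper ℂ E
  intro y₀ hy₀
  apply DifferentiableAt.differentiableWithinAt
  have hS : IsCompact (range (circleMap c ρ)) := by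
    rw [range_circleMap]
    exact isCompact_sphere _ _
  obtain ⟨u, v, -, hv, hSu, hyv, huv⟩ := generalized_tube_lemma hS (isCompact_singleton (x := y₀))
    hΩ (by rintro ⟨t, y⟩ ⟨⟨θ, rfl⟩, hy⟩; obtain rfl : y = y₀ := hy; exact hB y hy₀ θ)
  obtain ⟨δ, hδ, hδv⟩ := nhds_basis_closedBall.mem_iff.1
    (hv.mem_nhds (hyv (mem_singleton y₀)))
  have hsub : ∀ θ : ℝ, ∀ y ∈ closedBall y₀ δ, (circleMap c ρ θ, y) ∈ Ω := fun θ y hy =>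
    huv ⟨hSu ⟨θ, rfl⟩, hδv hy⟩
  have hcont := continuousOn_fderiv_of_holomorphic hΩ hH
  obtain ⟨C, hC⟩ := (hS.prod (isCompact_closedBall y₀ δ)).exists_bound_of_continuousOn
    (f := fderiv ℂ H) (hcont.mono (by
      rintro ⟨t, y⟩ ⟨⟨θ, rfl⟩, hy⟩; exact hsub θ y hy))
  let inr := ContinuousLinearMap.inr ℂ ℂ E
  let F' : E → ℝ → E →L[ℂ] ℂ := fun y θ =>
    deriv (circleMap c ρ) θ • (fderiv ℂ H (circleMap c ρ θ, y)).comp inr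
  have hpair : ∀ y : E, Continuous fun θ : ℝ => (circleMap c ρ θ, y) := fun y =>
    (continuous_circleMap c ρ).prodMk continuous_const
  have hcirc : Continuous fun θ : ℝ => circleMap 0 ρ θ * Complex.I :=
    (continuous_circleMap 0 ρ).mul continuous_const
  have hcc : ∀ y ∈ closedBall y₀ δ,
      Continuous (fun θ => deriv (circleMap c ρ) θ • H (circleMap c ρ θ, y)) := by
    intro y hy
    simp only [deriv_circleMap]
    refine hcirc.smul ?_
    exact hH.continuousOn.comp_continuous (hpair y) fun θ => hsub θ y hy
  refine (intervalIntegral.hasFDerivAt_integral_of_dominated_of_fderiv_le (𝕜 := ℂ)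
    (F' := F') (s := ball y₀ δ) (bound := fun _ => |ρ| * (C * ‖inr‖))
    (ball_mem_nhds y₀ hδ) ?_ ?_ ?_ ?_ ?_ ?_).differentiableAt
  · filter_upwards [ball_mem_nhds y₀ hδ] with y hy
    exact (hcc y (ball_subset_closedBall hy)).aestronglyMeasurable
  · exact (hcc y₀ (mem_closedBall_self hδ.le)).intervalIntegrable _ _
  · apply Continuous.aestronglyMeasurable
    simp only [F', deriv_circleMap]
    refine hcirc.smul ?_
    refine Continuous.clm_comp ?_ continuous_const
    exact hcont.comp_continuous (hpair y₀) fun θ => hsub θ y₀ (mem_closedBall_self hδ.le)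
  · refine Eventually.of_forall fun θ _ y hy => ?_
    simp only [F', norm_smul]
    have h1 : ‖deriv (circleMap c ρ) θ‖ = |ρ| := by simp [deriv_circleMap]
    rw [h1]
    refine mul_le_mul_of_nonneg_left ?_ (abs_nonneg _)
    refine (ContinuousLinearMap.opNorm_comp_le _ _).trans ?_
    exact mul_le_mul_of_nonneg_right (hC _ ⟨⟨θ, rfl⟩, ball_subset_closedBall hy⟩) (norm_nonneg _)
  · exact intervalIntegrable_const
  · refine Eventually.of_forall fun θ _ y hy => ?_
    have h1 := (hH.differentiableAt (hΩ.mem_nhds (hsub θ y (ball_subset_closedBall hy)))).hasFDerivAt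
    exact (h1.comp y (hasFDerivAt_prodMk_right (circleMap c ρ θ) y)).const_smul
      (deriv (circleMap c ρ) θ)

/-- Directional derivatives of holomorphic functions are holomorphic. -/
theorem differentiableOn_deriv_line {E : Type*} [NormedAddCommGroup E]
    [NormedSpace ℂ E] [FiniteDimensional ℂ E] {f : E → ℂ} {Ω : Set E} (hΩ : IsOpen Ω)
    (hf : DifferentiableOn ℂ f Ω) (e : E) :
    DifferentiableOn ℂ (fun p => deriv (fun s : ℂ => f (p + s • e)) 0) Ω := by
  intro p₀ hp₀
  apply DifferentiableAt.differentiableWithinAt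
  have hcont : Continuous fun q : ℂ × E => q.2 + q.1 • e := by fun_prop
  have hO : IsOpen ((fun q : ℂ × E => q.2 + q.1 • e) ⁻¹' Ω) := hΩ.preimage hcont
  have hmem : ((0 : ℂ), p₀) ∈ (fun q : ℂ × E => q.2 + q.1 • e) ⁻¹' Ω := by simpa using hp₀
  obtain ⟨ε, hε, hεΩ⟩ := Metric.isOpen_iff.1 hO _ hmem
  have hε' : ∀ s : ℂ, ∀ p : E, ‖s‖ < ε → dist p p₀ < ε → p + s • e ∈ Ω := by
    intro s p hs hp
    refine hεΩ (show (s, p) ∈ _ from ?_)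
    rw [mem_ball, Prod.dist_eq]
    simpa using ⟨hs, hp⟩
  let Ω' : Set (ℂ × E) := ((fun q : ℂ × E => q.2 + q.1 • e) ⁻¹' Ω) ∩ {q | q.1 ≠ 0}
  have hΩ' : IsOpen Ω' := hO.inter (isOpen_ne.preimage continuous_fst)
  have hH : DifferentiableOn ℂ (fun q : ℂ × E => (q.1 ^ 2)⁻¹ * f (q.2 + q.1 • e)) Ω' := by
    refine DifferentiableOn.mul (DifferentiableOn.inv (by fun_prop) fun q hq => ?_) ?_
    · exact pow_ne_zero 2 hq.2
    · exact hf.comp (by fun_prop) fun q hq => hq.1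
  have hmain := differentiableOn_circleIntegral_param hΩ' hH (c := 0) (ρ := ε / 2) (B := ball p₀ ε) (by
    intro y hy θ
    have hn : ‖circleMap 0 (ε / 2) θ‖ = ε / 2 := by
      simp [(half_pos hε).le]
    refine ⟨hε' _ _ ?_ hy, ?_⟩
    · rw [hn]; linarith
    · have : 0 < ‖circleMap 0 (ε / 2) θ‖ := by rw [hn]; linarith
      exact norm_pos_iff.1 this)
  have hd := (hmain.const_mul (2 * Real.pi * Complex.I)⁻¹).differentiableAt (ball_mem_nhds p₀ hε)
  refine hd.congr_of_eventuallyEq ?_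
  filter_upwards [ball_mem_nhds p₀ hε] with p hp
  have hfp : DifferentiableOn ℂ (fun s : ℂ => f (p + s • e)) (ball 0 ε) :=
    hf.comp (by fun_prop) fun s hs => hε' s p (by simpa using hs) hp
  have := Complex.two_pi_I_inv_smul_circleIntegral_sub_sq_inv_smul_of_differentiable
    isOpen_ball (closedBall_subset_ball (half_lt_self hε)) hfp
    (mem_ball_self (half_pos hε))
  rw [← this]
  simp

/-- A set of zeros of a holomorphic function on a disc, inside a smaller closed disc, is finite as
soon as the function has a nonzero value. -/
theorem finite_zeros_closedBall {f : ℂ → ℂ} {c : ℂ} {ρ R : ℝ} (hρR : ρ < R)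
    (hf : DifferentiableOn ℂ f (ball c R)) {t₁ : ℂ} (ht₁ : t₁ ∈ ball c R) (h₁ : f t₁ ≠ 0) :
    {t ∈ closedBall c ρ | f t = 0}.Finite := by
  by_contra hinf
  obtain ⟨x, hx, hacc⟩ := Set.Infinite.exists_accPt_of_subset_isCompact hinf
    (isCompact_closedBall c ρ) fun t ht => ht.1
  rw [accPt_iff_frequently_nhdsNE] at hacc
  have := (hf.analyticOnNhd isOpen_ball).eqOn_zero_of_preconnected_of_frequently_eq_zero
    (convex_ball c R).isPreconnected (closedBall_subset_ball hρR hx) (hacc.mono fun t ht => ht.2)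
  exact h₁ (this ht₁)

/-- The generalized argument principle on a disc: weighted sums over the zeros (counted with
multiplicity) of a holomorphic function are circle integrals. -/
theorem exists_multiset_zeros_circleIntegral {f : ℂ → ℂ} {c : ℂ} {ρ R : ℝ} (hρ : 0 < ρ)
    (hρR : ρ < R) (hf : DifferentiableOn ℂ f (ball c R)) (h₀ : ∀ t ∈ sphere c ρ, f t ≠ 0) :
    ∃ s : Multiset ℂ, (∀ t, t ∈ s ↔ t ∈ ball c ρ ∧ f t = 0) ∧
      ∀ φ : ℂ → ℂ, DifferentiableOn ℂ φ (ball c R) →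
        ∮ t in C(c, ρ), φ t * logDeriv f t = 2 * Real.pi * Complex.I * (s.map φ).sum := by
  have hsph : ∀ t ∈ sphere c ρ, t ∈ ball c R := fun t ht =>
    closedBall_subset_ball hρR (sphere_subset_closedBall ht)
  have hex : c + ρ ∈ sphere c ρ := by simp [abs_of_pos hρ]
  have hfin := finite_zeros_closedBall hρR hf (hsph _ hex) (h₀ _ hex)
  induction hn : {t ∈ closedBall c ρ | f t = 0}.ncard using Nat.strong_induction_on
    generalizing f with
  | _ n ih =>
  have hlog : ∀ {g : ℂ → ℂ}, DifferentiableOn ℂ g (ball c R) → ∀ t ∈ ball c R, g t ≠ 0 →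
      DifferentiableAt ℂ (logDeriv g) t := by
    intro g hg t ht hgt
    have hd : DifferentiableOn ℂ (deriv g) (ball c R) := hg.deriv isOpen_ball
    exact (hd.differentiableAt (isOpen_ball.mem_nhds ht)).div
      (hg.differentiableAt (isOpen_ball.mem_nhds ht)) hgt
  by_cases hne : ∃ a ∈ closedBall c ρ, f a = 0
  swap
  · push Not at hne
    refine ⟨0, fun t => ?_, fun φ hφ => ?_⟩
    · simpa using fun ht => hne t (ball_subset_closedBall ht)
    · simp only [Multiset.map_zero, Multiset.sum_zero, mul_zero]
      have hdd : ∀ t ∈ closedBall c ρ, DifferentiableAt ℂ (fun t => φ t * logDeriv f t) t := by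
        intro t ht
        have htR := closedBall_subset_ball hρR ht
        exact (hφ.differentiableAt (isOpen_ball.mem_nhds htR)).mul (hlog hf t htR (hne t ht))
      exact Complex.circleIntegral_eq_zero_of_differentiable_on_off_countable hρ.le countable_empty
        (fun t ht => (hdd t ht).continuousAt.continuousWithinAt)
        fun t ht => hdd t (ball_subset_closedBall ht.1)
  obtain ⟨a, haρ, hfa⟩ := hne
  have haR := closedBall_subset_ball hρR haρ
  have haball : a ∈ ball c ρ := by
    rcases (mem_closedBall.1 haρ).lt_or_eq with h | h
    · exact h
    · exact absurd hfa (h₀ a h)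
  have han := hf.analyticOnNhd isOpen_ball
  have hnz : ¬ ∀ᶠ z in 𝓝 a, f z = 0 := fun h =>
    h₀ _ hex (han.eqOn_zero_of_preconnected_of_eventuallyEq_zero
      (convex_ball c R).isPreconnected haR h (hsph _ hex))
  obtain ⟨m, g₀, hg₀, hg₀a, hfg₀⟩ := (han a haR).exists_eventuallyEq_pow_smul_nonzero_iff.2 hnz
  have hm : m ≠ 0 := by
    rintro rfl
    have := hfg₀.self_of_nhds
    simp only [pow_zero, one_smul] at this
    exact hg₀a (this ▸ hfa)
  let g : ℂ → ℂ := Function.update (fun t => f t / (t - a) ^ m) a (g₀ a)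
  have hga : g a = g₀ a := by simp [g]
  have hgne : ∀ t, t ≠ a → g t = f t / (t - a) ^ m := fun t ht => by simp [g, ht]
  have hfg : ∀ t, f t = (t - a) ^ m * g t := by
    intro t
    by_cases ht : t = a
    · subst ht; simp [hfa, hm]
    · rw [hgne t ht, mul_div_cancel₀]
      exact pow_ne_zero m (sub_ne_zero.2 ht)
  have hgd : DifferentiableOn ℂ g (ball c R) := by
    intro t ht
    apply DifferentiableAt.differentiableWithinAt
    by_cases hta : t = a
    · subst hta
      refine hg₀.differentiableAt.congr_of_eventuallyEq ?_
      filter_upwards [hfg₀] with z hz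
      by_cases hza : z = t
      · subst hza; exact hga
      · rw [hgne z hza, hz, smul_eq_mul, mul_div_cancel_left₀]
        exact pow_ne_zero m (sub_ne_zero.2 hza)
    · have h1 : DifferentiableAt ℂ (fun t => f t / (t - a) ^ m) t :=
        (hf.differentiableAt (isOpen_ball.mem_nhds ht)).div (by fun_prop)
          (pow_ne_zero m (sub_ne_zero.2 hta))
      refine h1.congr_of_eventuallyEq ?_
      filter_upwards [isOpen_ne.mem_nhds hta] with z hz
      exact hgne z hz
  have hgz : ∀ t, g t = 0 ↔ t ≠ a ∧ f t = 0 := by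
    intro t
    by_cases ht : t = a
    · subst ht; simp [hga, hg₀a]
    · rw [hgne t ht]
      simp [ht, pow_eq_zero_iff hm, sub_ne_zero.2 ht]
  have hss : {t ∈ closedBall c ρ | g t = 0} ⊂ {t ∈ closedBall c ρ | f t = 0} := by
    refine ⟨fun t ht => ⟨ht.1, ((hgz t).1 ht.2).2⟩, fun h => ?_⟩
    exact ((hgz a).1 (h ⟨haρ, hfa⟩).2).1 rfl
  have hg0 : ∀ t ∈ sphere c ρ, g t ≠ 0 := fun t ht h => h₀ t ht ((hgz t).1 h).2
  obtain ⟨s, hs, hint⟩ := ih _ (hn ▸ Set.ncard_lt_ncard hss hfin) hgd hg0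
    (hfin.subset hss.1) rfl
  refine ⟨Multiset.replicate m a + s, fun t => ?_, fun φ hφ => ?_⟩
  · rw [Multiset.mem_add, Multiset.mem_replicate, hs, hgz]
    by_cases hta : t = a
    · subst hta; simp [hm, hfa, haball]
    · simp [hta]
  · have hsplit : ∀ t ∈ sphere c ρ, φ t * logDeriv f t =
        m * ((t - a)⁻¹ • φ t) + φ t * logDeriv g t := by
      intro t ht
      have hta : t - a ≠ 0 := sub_ne_zero.2 fun h => h₀ t ht (h ▸ hfa)
      have : f = fun t => (t - a) ^ m * g t := funext hfg
      rw [this, logDeriv_mul (f := fun t => (t - a) ^ m) t (pow_ne_zero m hta) (hg0 t ht) (by fun_prop)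
        (hgd.differentiableAt (isOpen_ball.mem_nhds (hsph t ht))),
        logDeriv_fun_pow (f := fun t => t - a) (by fun_prop)]
      have : logDeriv (fun t => t - a) t = (t - a)⁻¹ := by
        simp [logDeriv_apply]
      rw [this, smul_eq_mul]
      ring
    have hφc : ContinuousOn φ (sphere c ρ) := hφ.continuousOn.mono hsph
    have hi1 : CircleIntegrable (fun t => (m : ℂ) * ((t - a)⁻¹ • φ t)) c ρ := by
      refine ContinuousOn.circleIntegrable hρ.le ?_
      have hinv : ContinuousOn (fun t => (t - a)⁻¹) (sphere c ρ) :=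
        ContinuousOn.inv₀ (by fun_prop) fun t ht => sub_ne_zero.2 fun h => h₀ t ht (h ▸ hfa)
      exact continuousOn_const.mul (hinv.smul hφc)
    have hi2 : CircleIntegrable (fun t => φ t * logDeriv g t) c ρ := by
      refine ContinuousOn.circleIntegrable hρ.le (hφc.mul fun t ht => ?_)
      exact (hlog hgd t (hsph t ht) (hg0 t ht)).continuousAt.continuousWithinAt
    rw [circleIntegral.integral_congr hρ.le hsplit, circleIntegral.integral_add hi1 hi2, hint φ hφ,
      circleIntegral.integral_const_mul, DiffContOnCl.circleIntegral_sub_inv_smul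
        (hφ.diffContOnCl_ball (closedBall_subset_ball hρR)) haball]
    simp
    ring

/-- If the power sums of a family of multisets of fixed cardinality are holomorphic, then so is
the product. -/
theorem differentiableOn_multiset_prod_of_powerSums {E : Type*} [NormedAddCommGroup E]
    [NormedSpace ℂ E] {B : Set E} {d : ℕ} {s : E → Multiset ℂ}
    (hcard : ∀ y ∈ B, (s y).card = d)
    (hp : ∀ k : ℕ, DifferentiableOn ℂ (fun y => ((s y).map (· ^ k)).sum) B) :
    DifferentiableOn ℂ (fun y => (s y).prod) B := by
  have hex : ∀ y, ∃ b : Fin d → ℂ, y ∈ B → s y = Finset.univ.val.map b := by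
    intro y
    by_cases hy : y ∈ B
    · obtain ⟨l, hl⟩ := Quot.exists_rep (s y)
      have hlen : l.length = d := by
        rw [← hcard y hy, ← hl]; rfl
      subst hlen
      refine ⟨l.get, fun _ => ?_⟩
      rw [← hl, Fin.univ_val_map, List.ofFn_get]
      rfl
    · exact ⟨0, fun h => absurd h hy⟩
  choose b hb using hex
  have hpsum : ∀ k : ℕ, DifferentiableOn ℂ
      (fun y => MvPolynomial.aeval (b y) (MvPolynomial.psum (Fin d) ℂ k)) B := by
    intro k
    refine (hp k).congr fun y hy => ?_
    rw [hb y hy, Multiset.map_map]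
    simp [MvPolynomial.psum, List.sum_ofFn]
  have hesymm : ∀ k : ℕ, DifferentiableOn ℂ
      (fun y => MvPolynomial.aeval (b y) (MvPolynomial.esymm (Fin d) ℂ k)) B := by
    intro k
    induction k using Nat.strong_induction_on with
    | _ k ih =>
    rcases Nat.eq_zero_or_pos k with rfl | hk
    · simp
    have hk0 : (k : ℂ) ≠ 0 := by exact_mod_cast hk.ne'
    have hN : ∀ y, MvPolynomial.aeval (b y) (MvPolynomial.esymm (Fin d) ℂ k) =
        (k : ℂ)⁻¹ * ((-1) ^ (k + 1) * ∑ a ∈ Finset.HasAntidiagonal.antidiagonal k with a.1 < k,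
          (-1) ^ a.1 * MvPolynomial.aeval (b y) (MvPolynomial.esymm (Fin d) ℂ a.1) *
            MvPolynomial.aeval (b y) (MvPolynomial.psum (Fin d) ℂ a.2)) := by
      intro y
      rw [eq_inv_mul_iff_mul_eq₀ hk0]
      have := congrArg (MvPolynomial.aeval (b y)) (MvPolynomial.mul_esymm_eq_sum (Fin d) ℂ k)
      simpa only [map_mul, map_natCast, map_pow, map_neg, map_one, map_sum] using this
    simp only [hN]
    refine DifferentiableOn.const_mul (DifferentiableOn.const_mul ?_ _) _
    refine DifferentiableOn.fun_sum fun a ha => ?_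
    exact ((ih a.1 (Finset.mem_filter.1 ha).2).const_mul _).mul (hpsum a.2)
  refine (hesymm d).congr fun y hy => ?_
  rw [hb y hy]
  have hps : Finset.powersetCard d (Finset.univ : Finset (Fin d)) = {Finset.univ} := by
    have := Finset.powersetCard_self (Finset.univ : Finset (Fin d))
    rwa [Finset.card_univ, Fintype.card_fin] at this
  rw [MvPolynomial.esymm, hps, Finset.sum_singleton, map_prod]
  simp only [MvPolynomial.aeval_X]
  rfl

/-- If for enough parameters `l` the product over `t ∈ s` of `∑ i, l ^ i * v t i` vanishes, then
some vector `v t` vanishes. -/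
theorem exists_eq_zero_of_prod_eval_eq_zero {α : Type*} {k : ℕ} (s : Multiset α)
    (v : α → Fin k → ℂ)
    (h : ∀ l : Fin (s.card * k + 1), (s.map fun t => ∑ i : Fin k, (l : ℂ) ^ (i : ℕ) * v t i).prod = 0) :
    ∃ t ∈ s, ∀ i, v t i = 0 := by
  open Polynomial in
  let q : α → ℂ[X] := fun t => ∑ i : Fin k, C (v t i) * X ^ (i : ℕ)
  have hdeg : (s.map q).prod.natDegree < s.card * k + 1 := by
    refine Nat.lt_succ_of_le ((Polynomial.natDegree_multiset_prod_le _).trans ?_)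
    have := Multiset.sum_le_card_nsmul ((s.map q).map Polynomial.natDegree) k (by
      intro x hx
      rw [Multiset.map_map, Multiset.mem_map] at hx
      obtain ⟨t, -, rfl⟩ := hx
      refine Polynomial.natDegree_sum_le_of_forall_le _ _ fun i _ => ?_
      exact (Polynomial.natDegree_C_mul_X_pow_le _ _).trans i.2.le)
    simpa using this
  have hzero : (s.map q).prod = 0 := by
    refine Polynomial.eq_zero_of_natDegree_lt_card_of_eval_eq_zero _
      (f := fun l : Fin (s.card * k + 1) => (l : ℂ)) ?_ ?_ (by simpa using hdeg)
    · intro l l' hl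
      exact Fin.ext (Nat.cast_injective (R := ℂ) hl)
    · intro l
      rw [Polynomial.eval_multiset_prod, Multiset.map_map, ← h l]
      congr 2
      funext t
      simp only [q, Function.comp_apply, Polynomial.eval_finsetSum, Polynomial.eval_mul,
        Polynomial.eval_C, Polynomial.eval_pow, Polynomial.eval_X]
      exact Finset.sum_congr rfl fun i _ => mul_comm _ _
  rw [Multiset.prod_eq_zero_iff, Multiset.mem_map] at hzero
  obtain ⟨t, hts, ht⟩ := hzero
  refine ⟨t, hts, fun i => ?_⟩
  have := congrArg (fun p => Polynomial.coeff p (i : ℕ)) ht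
  simpa [q, Polynomial.finsetSum_coeff, Polynomial.coeff_C_mul, Polynomial.coeff_X_pow,
    Fin.val_inj] using this

/-- Sums of a holomorphic function over the zeros of a holomorphic family of functions on a disc
depend holomorphically on the parameter. -/
theorem differentiableOn_sum_zeros {E : Type*} [NormedAddCommGroup E] [NormedSpace ℂ E]
    [FiniteDimensional ℂ E] {f h : ℂ × E → ℂ} {t₀ : ℂ} {ρ R : ℝ} {B : Set E} (hB : IsOpen B)
    (hρ : 0 < ρ) (hρR : ρ < R) (hf : DifferentiableOn ℂ f (ball t₀ R ×ˢ B))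
    (hh : DifferentiableOn ℂ h (ball t₀ R ×ˢ B))
    (hf0 : ∀ t ∈ sphere t₀ ρ, ∀ y ∈ B, f (t, y) ≠ 0) {s : E → Multiset ℂ}
    (hs : ∀ y ∈ B, ∀ φ : ℂ → ℂ, DifferentiableOn ℂ φ (ball t₀ R) →
        ∮ t in C(t₀, ρ), φ t * logDeriv (fun t => f (t, y)) t =
          2 * Real.pi * Complex.I * ((s y).map φ).sum) :
    DifferentiableOn ℂ (fun y => ((s y).map fun t => h (t, y)).sum) B := by
  have hO : IsOpen (ball t₀ R ×ˢ B) := isOpen_ball.prod hB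
  let Ω : Set (ℂ × E) := {p ∈ ball t₀ R ×ˢ B | f p ≠ 0}
  have hΩ : IsOpen Ω := hf.continuousOn.isOpen_inter_preimage hO isOpen_ne
  have hΩs : Ω ⊆ ball t₀ R ×ˢ B := fun p hp => hp.1
  have hd := differentiableOn_deriv_line hO hf ((1 : ℂ), (0 : E))
  have hH : DifferentiableOn ℂ
      (fun p => h p * (deriv (fun s : ℂ => f (p + s • ((1 : ℂ), (0 : E)))) 0 * (f p)⁻¹)) Ω :=
    (hh.mono hΩs).mul ((hd.mono hΩs).mul ((hf.mono hΩs).inv fun p hp => hp.2))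
  have hmain := differentiableOn_circleIntegral_param hΩ hH (c := t₀) (ρ := ρ) (B := B) (by
    intro y hy θ
    have hsph := circleMap_mem_sphere t₀ hρ.le θ
    exact ⟨⟨closedBall_subset_ball hρR (sphere_subset_closedBall hsph), hy⟩, hf0 _ hsph y hy⟩)
  refine (hmain.const_mul (2 * Real.pi * Complex.I)⁻¹).congr fun y hy => ?_
  have hpi : (2 * Real.pi * Complex.I : ℂ) ≠ 0 := Complex.two_pi_I_ne_zero
  have hslice : DifferentiableOn ℂ (fun t => h (t, y)) (ball t₀ R) :=
    hh.comp (by fun_prop) fun t ht => ⟨ht, hy⟩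
  rw [eq_inv_mul_iff_mul_eq₀ hpi, ← hs y hy _ hslice]
  congr 1
  funext t
  rw [logDeriv_apply, div_eq_mul_inv]
  congr 2
  have : (fun s : ℂ => f ((t, y) + s • ((1 : ℂ), (0 : E)))) = fun s => (fun t => f (t, y)) (t + s) := by
    funext s; simp
  rw [this, deriv_comp_const_add (fun t => f (t, y)) t 0, add_zero]

/-- Local elimination of one variable: near a point whose fibre is isolated, the projection of a
common zero set of holomorphic functions is a common zero set of holomorphic functions. -/
theorem exists_local_elimination {E : Type*} [NormedAddCommGroup E] [NormedSpace ℂ E]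
    [FiniteDimensional ℂ E] {k : ℕ} {f : Fin k → ℂ × E → ℂ} {W : Set (ℂ × E)} (hW : IsOpen W)
    (hf : ∀ i, DifferentiableOn ℂ (f i) W) {t₀ : ℂ} {y₀ : E} (h₀ : (t₀, y₀) ∈ W)
    (hiso : ∀ᶠ t in 𝓝[≠] t₀, ∃ i, f i (t, y₀) ≠ 0) :
    ∃ ρ > 0, ∃ r > 0, ball t₀ ρ ×ˢ ball y₀ r ⊆ W ∧ ∃ (N : ℕ) (g : Fin N → E → ℂ),
      (∀ l, DifferentiableOn ℂ (g l) (ball y₀ r)) ∧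
      ∀ y ∈ ball y₀ r, (∀ l, g l y = 0) ↔ ∃ t ∈ ball t₀ ρ, ∀ i, f i (t, y) = 0 := by
  obtain ⟨i₀, hi₀⟩ : ∃ i, ∀ᶠ t in 𝓝[≠] t₀, f i (t, y₀) ≠ 0 := by
    by_contra! hcon
    have hall : ∀ i, ∀ᶠ t in 𝓝[≠] t₀, f i (t, y₀) = 0 := by
      intro i
      have hO : IsOpen ((fun t : ℂ => (t, y₀)) ⁻¹' W) := hW.preimage (by fun_prop)
      have hd : DifferentiableOn ℂ (fun t => f i (t, y₀)) ((fun t : ℂ => (t, y₀)) ⁻¹' W) :=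
        (hf i).comp (by fun_prop) fun t ht => ht
      rcases (hd.analyticAt (hO.mem_nhds h₀)).eventually_eq_zero_or_eventually_ne_zero with h | h
      · exact h.filter_mono nhdsWithin_le_nhds
      · exact absurd h (hcon i)
    obtain ⟨t, ⟨i, hi⟩, ht⟩ := (hiso.and (eventually_all.2 hall)).exists
    exact hi (ht i)
  obtain ⟨R₁, hR₁, hR₁W⟩ := Metric.isOpen_iff.1 hW _ h₀
  obtain ⟨R₂, hR₂, hR₂f⟩ := Metric.eventually_nhds_iff_ball.1 (eventually_nhdsWithin_iff.1 hi₀)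
  obtain ⟨R, hR, hRR₁, hRR₂⟩ : ∃ R > 0, R ≤ R₁ ∧ R ≤ R₂ :=
    ⟨min R₁ R₂, lt_min hR₁ hR₂, min_le_left _ _, min_le_right _ _⟩
  have hρ : 0 < R / 2 := by positivity
  have hρR : R / 2 < R := by linarith
  have hbox : ∀ r ≤ R, ball t₀ R ×ˢ ball y₀ r ⊆ W := by
    intro r hr
    refine Subset.trans ?_ hR₁W
    rw [← ball_prod_same]
    exact Set.prod_mono (ball_subset_ball hRR₁) (ball_subset_ball (hr.trans hRR₁))
  have hΩ : IsOpen {p ∈ W | f i₀ p ≠ 0} := (hf i₀).continuousOn.isOpen_inter_preimage hW isOpen_ne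
  obtain ⟨u, v, -, hv, hu, hyv, huv⟩ := generalized_tube_lemma (isCompact_sphere t₀ (R / 2))
    (isCompact_singleton (x := y₀)) hΩ (by
      rintro ⟨t, y⟩ ⟨ht, hy⟩
      obtain rfl : y = y₀ := hy
      have htR : t ∈ ball t₀ R := closedBall_subset_ball hρR (sphere_subset_closedBall ht)
      refine ⟨hbox R le_rfl ⟨htR, mem_ball_self hR⟩, ?_⟩
      exact hR₂f t (ball_subset_ball hRR₂ htR) (ne_of_mem_sphere ht hρ.ne'))
  obtain ⟨r₁, hr₁, hr₁v⟩ := Metric.isOpen_iff.1 hv y₀ (hyv (mem_singleton y₀))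
  obtain ⟨r, hr, hrR, hrr₁⟩ : ∃ r > 0, r ≤ R ∧ r ≤ r₁ :=
    ⟨min R r₁, lt_min hR hr₁, min_le_left _ _, min_le_right _ _⟩
  have hf0 : ∀ t ∈ sphere t₀ (R / 2), ∀ y ∈ ball y₀ r, f i₀ (t, y) ≠ 0 := fun t ht y hy =>
    (huv ⟨hu ht, hr₁v (ball_subset_ball hrr₁ hy)⟩).2
  have hfd : ∀ i, DifferentiableOn ℂ (f i) (ball t₀ R ×ˢ ball y₀ r) := fun i =>
    (hf i).mono (hbox r hrR)
  have hzeros : ∀ y, ∃ s : Multiset ℂ, y ∈ ball y₀ r →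
      (∀ t, t ∈ s ↔ t ∈ ball t₀ (R / 2) ∧ f i₀ (t, y) = 0) ∧
      ∀ φ : ℂ → ℂ, DifferentiableOn ℂ φ (ball t₀ R) →
        ∮ t in C(t₀, R / 2), φ t * logDeriv (fun t => f i₀ (t, y)) t =
          2 * Real.pi * Complex.I * (s.map φ).sum := by
    intro y
    by_cases hy : y ∈ ball y₀ r
    · have hd : DifferentiableOn ℂ (fun t => f i₀ (t, y)) (ball t₀ R) :=
        (hfd i₀).comp (by fun_prop) fun t ht => ⟨ht, hy⟩
      obtain ⟨s, hs⟩ := exists_multiset_zeros_circleIntegral hρ hρR hd fun t ht => hf0 t ht y hy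
      exact ⟨s, fun _ => hs⟩
    · exact ⟨0, fun h => absurd h hy⟩
  choose s hs using hzeros
  have hsum : ∀ h : ℂ × E → ℂ, DifferentiableOn ℂ h (ball t₀ R ×ˢ ball y₀ r) →
      DifferentiableOn ℂ (fun y => ((s y).map fun t => h (t, y)).sum) (ball y₀ r) := fun h hh =>
    differentiableOn_sum_zeros isOpen_ball hρ hρR (hfd i₀) hh hf0 fun y hy => (hs y hy).2
  have hcard : ContinuousAt (fun y => ((s y).card : ℂ)) y₀ := by
    have := (hsum (fun _ => 1) (differentiableOn_const 1)).continuousOn.continuousAt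
      (ball_mem_nhds y₀ hr)
    simpa using this
  obtain ⟨r₂, hr₂, hr₂c⟩ := Metric.continuousAt_iff.1 hcard 1 one_pos
  obtain ⟨r', hr', hr'r, hr'r₂⟩ : ∃ r' > 0, r' ≤ r ∧ r' ≤ r₂ :=
    ⟨min r r₂, lt_min hr hr₂, min_le_left _ _, min_le_right _ _⟩
  have hconst : ∀ y ∈ ball y₀ r', (s y).card = (s y₀).card := by
    intro y hy
    have h1 := hr₂c (ball_subset_ball hr'r₂ hy)
    rw [← Complex.ofReal_natCast, ← Complex.ofReal_natCast, Complex.dist_eq, ← Complex.ofReal_sub,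
      Complex.norm_real, Real.norm_eq_abs] at h1
    have h2 : |((s y).card : ℤ) - (s y₀).card| < 1 := by exact_mod_cast h1
    rw [Int.abs_lt_one_iff, sub_eq_zero] at h2
    exact_mod_cast h2
  have hsub : ball y₀ r' ⊆ ball y₀ r := ball_subset_ball hr'r
  refine ⟨R / 2, hρ, r', hr', ?_, (s y₀).card * k + 1,
    fun l y => ((s y).map fun t => ∑ i : Fin k, (l : ℂ) ^ (i : ℕ) * f i (t, y)).prod, ?_, ?_⟩
  · exact (Set.prod_mono (ball_subset_ball hρR.le) (ball_subset_ball hr'r)).trans (hbox r hrR)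
  · intro l
    refine differentiableOn_multiset_prod_of_powerSums (d := (s y₀).card)
      (s := fun y => (s y).map fun t => ∑ i : Fin k, (l : ℂ) ^ (i : ℕ) * f i (t, y))
      (fun y hy => by rw [Multiset.card_map]; exact hconst y hy) fun m => ?_
    simp only [Multiset.map_map, Function.comp_apply]
    refine (hsum (fun p => (∑ i : Fin k, (l : ℂ) ^ (i : ℕ) * f i p) ^ m) ?_).mono hsub
    exact DifferentiableOn.pow (DifferentiableOn.fun_sum fun i _ => (hfd i).const_mul _) m
  · intro y hy
    have hsy := (hs y (hsub hy)).1
    constructor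
    · intro h
      obtain ⟨t, ht, hft⟩ := exists_eq_zero_of_prod_eval_eq_zero (s y) (fun t i => f i (t, y))
        (by rw [hconst y hy]; exact h)
      exact ⟨t, ((hsy t).1 ht).1, hft⟩
    · rintro ⟨t, ht, hft⟩ l
      refine Multiset.prod_eq_zero (Multiset.mem_map.2 ⟨t, (hsy t).2 ⟨ht, hft i₀⟩, ?_⟩)
      simp [hft]

/-- Near `a`, the set `A` is the common zero set of finitely many holomorphic functions. -/
def IsLocallyZeroSetAt {E : Type*} [NormedAddCommGroup E] [NormedSpace ℂ E] (A : Set E) (a : E) :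
    Prop :=
  ∃ W : Set E, IsOpen W ∧ a ∈ W ∧ ∃ (k : ℕ) (f : Fin k → E → ℂ),
    (∀ i, DifferentiableOn ℂ (f i) W) ∧ A ∩ W = {z ∈ W | ∀ i, f i z = 0}

theorem IsLocallyZeroSetAt.of_finite {E : Type*} [NormedAddCommGroup E] [NormedSpace ℂ E]
    {A W : Set E} {a : E} (hW : IsOpen W) (ha : a ∈ W) {ι : Type*} [Finite ι] {f : ι → E → ℂ}
    (hf : ∀ i, DifferentiableOn ℂ (f i) W) (hA : A ∩ W = {z ∈ W | ∀ i, f i z = 0}) :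
    IsLocallyZeroSetAt A a := by
  obtain ⟨k, ⟨e⟩⟩ := Finite.exists_equiv_fin ι
  refine ⟨W, hW, ha, k, fun i => f (e.symm i), fun i => hf _, ?_⟩
  rw [hA]
  ext z
  simp only [mem_ofPred_eq, e.symm.forall_congr_left, Equiv.symm_symm, Equiv.symm_apply_apply]

theorem IsLocallyZeroSetAt.preimage {E E' : Type*} [NormedAddCommGroup E] [NormedSpace ℂ E]
    [NormedAddCommGroup E'] [NormedSpace ℂ E'] {A : Set E} {a : E'} (e : E' →L[ℂ] E)
    (h : IsLocallyZeroSetAt A (e a)) : IsLocallyZeroSetAt (e ⁻¹' A) a := by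
  obtain ⟨W, hW, ha, k, f, hf, hA⟩ := h
  refine ⟨e ⁻¹' W, hW.preimage e.continuous, ha, k, fun i z => f i (e z), fun i => ?_, ?_⟩
  · exact (hf i).comp e.differentiable.differentiableOn fun z hz => hz
  · rw [← preimage_inter, hA]
    rfl

/-- A compact subset of the complex line is discrete if it is locally a zero set of holomorphic
functions. -/
theorem eventually_notMem_of_isCompact_of_isLocallyZeroSetAt {S : Set ℂ} (hS : IsCompact S)
    (hloc : ∀ t ∈ S, IsLocallyZeroSetAt S t) {t : ℂ} (ht : t ∈ S) : ∀ᶠ t' in 𝓝[≠] t, t' ∉ S := by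
  have key : ∀ t ∈ S, (∃ᶠ t' in 𝓝[≠] t, t' ∈ S) → t ∈ interior S := by
    intro t ht hfreq
    obtain ⟨W, hW, htW, k, f, hf, hSW⟩ := hloc t ht
    have hWn : W ∈ 𝓝[≠] t := mem_nhdsWithin_of_mem_nhds (hW.mem_nhds htW)
    have hev : ∀ i, ∀ᶠ t' in 𝓝 t, f i t' = 0 := by
      intro i
      have han := (hf i).analyticAt (hW.mem_nhds htW)
      refine han.frequently_zero_iff_eventually_zero.1 ?_
      refine (hfreq.and_eventually hWn).mono fun t' ht' => ?_
      have : t' ∈ S ∩ W := ht'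
      rw [hSW] at this
      exact this.2 i
    rw [mem_interior_iff_mem_nhds]
    filter_upwards [eventually_all.2 hev, hW.mem_nhds htW] with t' ht' htW'
    have : t' ∈ {z ∈ W | ∀ i, f i z = 0} := ⟨htW', ht'⟩
    rw [← hSW] at this
    exact this.1
  have hclosed : IsClosed (interior S) := by
    refine isClosed_of_closure_subset fun t ht => ?_
    by_contra hnot
    refine hnot (key t (hS.isClosed.closure_subset_iff.2 interior_subset ht) ?_)
    rw [frequently_nhdsWithin_iff]
    refine (mem_closure_iff_frequently.1 ht).mono fun t' ht' => ⟨interior_subset ht', ?_⟩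
    rintro rfl
    exact hnot ht'
  rcases isClopen_iff.1 ⟨hclosed, isOpen_interior⟩ with h | h
  · by_contra hcon
    have := key t ht (fun h => hcon h)
    rw [h] at this
    exact this
  · have huniv : S = univ := univ_subset_iff.1 (h ▸ interior_subset)
    exact absurd (huniv ▸ hS) (noncompact_univ ℂ)

/-- The image under a proper projection along a line of a set which is locally a zero set of
holomorphic functions is again of this form. -/
theorem isLocallyZeroSetAt_snd_image_line {E : Type*} [NormedAddCommGroup E] [NormedSpace ℂ E]
    [FiniteDimensional ℂ E] {A : Set (ℂ × E)} (hA : ∀ a ∈ A, IsLocallyZeroSetAt A a) {V : Set E}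
    (hV : IsOpen V) (hAV : Prod.snd '' A ⊆ V)
    (hproper : ∀ K ⊆ V, IsCompact K → IsCompact (A ∩ Prod.snd ⁻¹' K)) :
    ∀ b ∈ Prod.snd '' A, IsLocallyZeroSetAt (Prod.snd '' A) b := by
  have : ProperSpace E := FiniteDimensional.proper ℂ E
  intro y₀ hy₀
  have hy₀V := hAV hy₀
  let S : Set ℂ := (fun t => (t, y₀)) ⁻¹' A
  have hS : IsCompact S := by
    have h1 := (hproper {y₀} (singleton_subset_iff.2 hy₀V) isCompact_singleton).image
      continuous_fst
    convert h1 using 1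
    ext t
    constructor
    · intro ht
      exact ⟨(t, y₀), ⟨ht, rfl⟩, rfl⟩
    · rintro ⟨⟨t', y⟩, ⟨ht, hy⟩, rfl⟩
      obtain rfl : y = y₀ := hy
      exact ht
  have hSloc : ∀ t ∈ S, IsLocallyZeroSetAt S t := by
    intro t ht
    obtain ⟨W, hW, htW, k, f, hf, hAW⟩ := hA _ ht
    refine ⟨(fun t => (t, y₀)) ⁻¹' W, hW.preimage (by fun_prop), htW, k,
      fun i t => f i (t, y₀), fun i => (hf i).comp (by fun_prop) fun t ht => ht, ?_⟩
    rw [← preimage_inter, hAW]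
    rfl
  have helim : ∀ x : S, ∃ ρ > 0, ∃ r > 0, ∃ (N : ℕ) (g : Fin N → E → ℂ),
      (∀ l, DifferentiableOn ℂ (g l) (ball y₀ r)) ∧
      ∀ y ∈ ball y₀ r, (∀ l, g l y = 0) ↔ ∃ t ∈ ball (x : ℂ) ρ, (t, y) ∈ A := by
    rintro ⟨t, ht⟩
    obtain ⟨W, hW, htW, k, f, hf, hAW⟩ := hA _ ht
    have hWpre : ∀ᶠ t' in 𝓝[≠] t, (t', y₀) ∈ W :=
      mem_nhdsWithin_of_mem_nhds ((hW.preimage (f := fun t' : ℂ => (t', y₀))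
        (by fun_prop)).mem_nhds htW)
    obtain ⟨ρ, hρ, r, hr, hsub, N, g, hg, hgA⟩ := exists_local_elimination hW hf htW (by
      filter_upwards [hWpre, eventually_notMem_of_isCompact_of_isLocallyZeroSetAt hS hSloc ht]
        with t' h1 h2
      by_contra! hcon
      have : (t', y₀) ∈ {z ∈ W | ∀ i, f i z = 0} := ⟨h1, hcon⟩
      rw [← hAW] at this
      exact h2 this.1)
    refine ⟨ρ, hρ, r, hr, N, g, hg, fun y hy => (hgA y hy).trans ?_⟩
    refine exists_congr fun t' => and_congr_right fun ht' => ?_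
    have hmem : (t', y) ∈ W := hsub ⟨ht', hy⟩
    have hiff := Set.ext_iff.1 hAW (t', y)
    simp only [mem_inter_iff, mem_ofPred_eq, hmem, and_true, true_and] at hiff
    exact hiff.symm
  choose ρ hρ r hr N g hg hgA using helim
  obtain ⟨T, hT⟩ := hS.elim_nhds_subcover' (fun t ht => ball t (ρ ⟨t, ht⟩))
    fun t ht => ball_mem_nhds t (hρ _)
  obtain ⟨ε, hε, hεV⟩ := nhds_basis_closedBall.mem_iff.1 (hV.mem_nhds hy₀V)
  let O : Set (ℂ × E) := ⋃ x ∈ T, Prod.fst ⁻¹' ball (x : ℂ) (ρ x)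
  have hO : IsOpen O := isOpen_biUnion fun x _ => isOpen_ball.preimage continuous_fst
  have hK := (((hproper _ hεV (isCompact_closedBall y₀ ε)).diff hO).image continuous_snd).isClosed
  let W : Set E := (ball y₀ ε ∩
    (Prod.snd '' ((A ∩ Prod.snd ⁻¹' closedBall y₀ ε) \ O))ᶜ) ∩ ⋂ x ∈ T, ball y₀ (r x)
  have hW : IsOpen W := (isOpen_ball.inter hK.isOpen_compl).inter
    (isOpen_biInter_finset fun x _ => isOpen_ball)
  have hy₀W : y₀ ∈ W := by
    refine ⟨⟨mem_ball_self hε, ?_⟩, mem_iInter₂.2 fun x _ => mem_ball_self (hr x)⟩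
    rintro ⟨⟨t, y⟩, ⟨⟨htA, -⟩, htO⟩, hy⟩
    obtain rfl : y = y₀ := hy
    obtain ⟨x, hx, htx⟩ := mem_iUnion₂.1 (hT htA)
    exact htO (mem_iUnion₂.2 ⟨x, hx, htx⟩)
  refine IsLocallyZeroSetAt.of_finite hW hy₀W (ι := ∀ x : {x // x ∈ T}, Fin (N x.1))
    (f := fun c y => ∏ x : {x // x ∈ T}, g x.1 (c x) y) ?_ ?_
  · intro c
    classical
    exact fun y hy => (HasFDerivWithinAt.finsetProd fun x _ =>
      ((hg x.1 (c x)).mono (fun z hz => mem_iInter₂.1 hz.2 x.1 x.2) y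
        hy).hasFDerivWithinAt).differentiableWithinAt
  · ext y
    simp only [mem_inter_iff, mem_ofPred_eq]
    rw [and_comm]
    refine and_congr_right fun hy => ?_
    have hyr : ∀ x ∈ T, y ∈ ball y₀ (r x) := fun x hx => mem_iInter₂.1 hy.2 x hx
    constructor
    · rintro ⟨⟨t, y'⟩, htA, rfl⟩ c
      have htO : (t, y') ∈ O := by
        by_contra hnot
        exact hy.1.2 ⟨(t, y'), ⟨⟨htA, ball_subset_closedBall hy.1.1⟩, hnot⟩, rfl⟩
      obtain ⟨x, hx, htx⟩ := mem_iUnion₂.1 htO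
      exact Finset.prod_eq_zero (Finset.mem_univ (⟨x, hx⟩ : {x // x ∈ T}))
        ((hgA x y' (hyr x hx)).2 ⟨t, htx, htA⟩ _)
    · intro hall
      by_contra hnot
      have hne : ∀ x : {x // x ∈ T}, ∃ l, g x l y ≠ 0 := by
        intro x
        by_contra! hcon
        obtain ⟨t, -, htA⟩ := (hgA x y (hyr x x.2)).1 hcon
        exact hnot ⟨(t, y), htA, rfl⟩
      choose c hc using hne
      exact Finset.prod_ne_zero_iff.2 (fun x _ => hc x) (hall c)

/-- The image under a proper projection along `ℂⁿ` of a set which is locally a zero set of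
holomorphic functions is again of this form. -/
theorem isLocallyZeroSetAt_snd_image (n : ℕ) {E : Type*} [NormedAddCommGroup E] [NormedSpace ℂ E]
    [FiniteDimensional ℂ E] {A : Set ((Fin n → ℂ) × E)} (hA : ∀ a ∈ A, IsLocallyZeroSetAt A a)
    {V : Set E} (hV : IsOpen V) (hAV : Prod.snd '' A ⊆ V)
    (hproper : ∀ K ⊆ V, IsCompact K → IsCompact (A ∩ Prod.snd ⁻¹' K)) :
    ∀ b ∈ Prod.snd '' A, IsLocallyZeroSetAt (Prod.snd '' A) b := by
  induction n with
  | zero =>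
    have heq : Prod.snd '' A = ContinuousLinearMap.inr ℂ (Fin 0 → ℂ) E ⁻¹' A := by
      ext y
      constructor
      · rintro ⟨⟨x, y'⟩, h, rfl⟩
        obtain rfl : x = 0 := Subsingleton.elim _ _
        exact h
      · intro h
        exact ⟨_, h, rfl⟩
    rw [heq]
    exact fun b hb => (hA _ hb).preimage _
  | succ n ih =>
    let e : (ℂ × ((Fin n → ℂ) × E)) ≃L[ℂ] (Fin (n + 1) → ℂ) × E :=
      (ContinuousLinearEquiv.prodAssoc ℂ ℂ (Fin n → ℂ) E).symm.trans
        ((Fin.consEquivL ℂ fun _ : Fin (n + 1) => ℂ).prodCongr (ContinuousLinearEquiv.refl ℂ E))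
    have he : ∀ p, (e p).2 = p.2.2 := fun p => rfl
    have hV' : IsOpen (Prod.snd ⁻¹' V : Set ((Fin n → ℂ) × E)) := hV.preimage continuous_snd
    have hcomp : ∀ K ⊆ V, IsCompact K → IsCompact (e ⁻¹' A ∩ {p | p.2.2 ∈ K}) := by
      intro K hKV hK
      have := (hproper K hKV hK).image e.symm.continuous
      rw [e.symm.image_eq_preimage_symm] at this
      exact this
    have himg : Prod.snd '' (Prod.snd '' (e ⁻¹' A)) = Prod.snd '' A := by
      ext y
      constructor
      · rintro ⟨_, ⟨p, hp, rfl⟩, rfl⟩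
        exact ⟨e p, hp, he p⟩
      · rintro ⟨q, hq, rfl⟩
        refine ⟨_, ⟨e.symm q, by simpa using hq, rfl⟩, ?_⟩
        rw [← he, e.apply_symm_apply]
    have h1 := isLocallyZeroSetAt_snd_image_line (A := e ⁻¹' A)
      (fun a ha => (hA (e a) ha).preimage
        (e : (ℂ × ((Fin n → ℂ) × E)) →L[ℂ] ((Fin (n + 1) → ℂ) × E))) hV' (by
        rintro _ ⟨p, hp, rfl⟩
        exact hAV ⟨e p, hp, he p⟩) (by
        intro K hKV hK
        have hK2 : IsCompact (Prod.snd '' K) := hK.image continuous_snd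
        have := (hcomp _ (image_subset_iff.2 hKV) hK2).inter_right
          (hK.isClosed.preimage continuous_snd)
        convert this using 1
        ext p
        simp only [mem_inter_iff, mem_preimage, mem_ofPred_eq]
        constructor
        · rintro ⟨ha, hb⟩
          exact ⟨⟨ha, mem_image_of_mem _ hb⟩, hb⟩
        · rintro ⟨⟨ha, -⟩, hb⟩
          exact ⟨ha, hb⟩)
    rw [← himg]
    refine ih h1 (himg.trans_subset hAV) fun K hKV hK => ?_
    have := (hcomp K hKV hK).image continuous_snd
    convert this using 1
    ext q
    constructor
    · rintro ⟨⟨p, hp, rfl⟩, hq⟩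
      exact ⟨p, ⟨hp, hq⟩, rfl⟩
    · rintro ⟨p, ⟨hp, hq⟩, rfl⟩
      exact ⟨⟨p, hp, rfl⟩, hq⟩

/-- The image of a proper map into an open set is relatively closed. -/
theorem mem_image_of_mem_closure_of_proper {X E : Type*} [TopologicalSpace X]
    [PseudoMetricSpace E] [T2Space E] [ProperSpace E] {F : X → E} {A : Set X}
    (hF : ContinuousOn F A) {V : Set E} (hV : IsOpen V)
    (hproper : ∀ K ⊆ V, IsCompact K → IsCompact (A ∩ F ⁻¹' K)) {z : E} (hzV : z ∈ V)
    (hz : z ∈ closure (F '' A)) : z ∈ F '' A := by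
  obtain ⟨ε, hε, hεV⟩ := nhds_basis_closedBall.mem_iff.1 (hV.mem_nhds hzV)
  have hcl := ((hproper _ hεV (isCompact_closedBall z ε)).image_of_continuousOn
    (hF.mono inter_subset_left)).isClosed
  have hmem : z ∈ closure (F '' (A ∩ F ⁻¹' closedBall z ε)) := by
    rw [mem_closure_iff_frequently] at hz ⊢
    refine (hz.and_eventually (closedBall_mem_nhds z hε)).mono ?_
    rintro _ ⟨⟨x, hx, rfl⟩, hx'⟩
    exact ⟨x, ⟨hx, hx'⟩, rfl⟩
  rw [hcl.closure_eq] at hmem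
  exact image_mono inter_subset_left hmem

/-- **Remmert's proper mapping theorem** (for domains).  Let `U ⊆ ℂⁿ` and `V ⊆ ℂᵐ` be open,
`F` holomorphic on `U`, and `A` an analytic subset of `U` with `F(A) ⊆ V`.  If the restriction
`F : A → V` is proper (preimages in `A` of compact subsets of `V` are compact), then the image
`F(A)` is an analytic subset of `V`. -/
theorem remmert_proper_mapping_theorem (n m : ℕ)
    (U : Set (EuclideanSpace ℂ (Fin n))) (hU : IsOpen U)
    (V : Set (EuclideanSpace ℂ (Fin m))) (hV : IsOpen V)
    (F : EuclideanSpace ℂ (Fin n) → EuclideanSpace ℂ (Fin m))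
    (hF : DifferentiableOn ℂ F U)
    (A : Set (EuclideanSpace ℂ (Fin n))) (hA : IsAnalyticSubset U A)
    (hFA : F '' A ⊆ V)
    (hproper : ∀ K : Set (EuclideanSpace ℂ (Fin m)), K ⊆ V → IsCompact K →
      IsCompact (A ∩ F ⁻¹' K)) :
    IsAnalyticSubset V (F '' A) := by
  obtain ⟨hAU, -, hAloc⟩ := hA
  have hFA' : ContinuousOn F A := hF.continuousOn.mono hAU
  let e : EuclideanSpace ℂ (Fin n) ≃L[ℂ] (Fin n → ℂ) := EuclideanSpace.equiv (Fin n) ℂ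
  let G : Set ((Fin n → ℂ) × EuclideanSpace ℂ (Fin m)) :=
    {p | e.symm p.1 ∈ A ∧ p.2 = F (e.symm p.1)}
  have hG : G = (fun z => (e z, F z)) '' A := by
    ext ⟨x, w⟩
    constructor
    · rintro ⟨hx, hw⟩
      exact ⟨e.symm x, hx, Prod.ext (e.apply_symm_apply x) hw.symm⟩
    · rintro ⟨z, hz, h⟩
      obtain ⟨rfl, rfl⟩ := Prod.mk.inj h
      simpa [G] using hz
  have hsnd : Prod.snd '' G = F '' A := by
    rw [hG, image_image]
  have hGloc : ∀ p ∈ G, IsLocallyZeroSetAt G p := by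
    rintro p ⟨hpA, hp⟩
    obtain ⟨W, hW, haW, hWU, k, f, hf, hAW⟩ := hAloc _ hpA
    refine IsLocallyZeroSetAt.of_finite 
      (W := (fun p : (Fin n → ℂ) × EuclideanSpace ℂ (Fin m) => e.symm p.1) ⁻¹' W)
      (hW.preimage (by fun_prop)) haW (ι := Fin k ⊕ Fin m)
      (f := Sum.elim (fun i p => f i (e.symm p.1)) fun j p => p.2 j - F (e.symm p.1) j) ?_ ?_
    · rintro (i | j)
      · exact (hf i).comp (t := W) (by fun_prop) fun p hp => hp
      · have hFc : DifferentiableOn ℂ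
            (fun p : (Fin n → ℂ) × EuclideanSpace ℂ (Fin m) => F (e.symm p.1))
            ((fun p : (Fin n → ℂ) × EuclideanSpace ℂ (Fin m) => e.symm p.1) ⁻¹' W) :=
          hF.comp (t := U) (by fun_prop) fun p hp => hWU hp
        have hpr : Differentiable ℂ fun w : EuclideanSpace ℂ (Fin m) => w j :=
          (EuclideanSpace.proj (𝕜 := ℂ) j).differentiable
        exact ((hpr.comp differentiable_snd).differentiableOn).sub (hpr.comp_differentiableOn hFc)
    · ext q
      have hiff := Set.ext_iff.1 hAW (e.symm q.1)
      simp only [mem_inter_iff, mem_ofPred_eq, mem_preimage, G, Sum.forall, Sum.elim_inl,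
        Sum.elim_inr, sub_eq_zero] at hiff ⊢
      have hext : q.2 = F (e.symm q.1) ↔ ∀ j, q.2 j = F (e.symm q.1) j := PiLp.ext_iff
      rw [hext]
      tauto
  have hGproper : ∀ K ⊆ V, IsCompact K → IsCompact (G ∩ Prod.snd ⁻¹' K) := by
    intro K hKV hK
    have := (hproper K hKV hK).image_of_continuousOn (f := fun z => (e z, F z))
      (e.continuous.continuousOn.prodMk (hFA'.mono inter_subset_left))
    convert this using 1
    rw [hG]
    ext q
    constructor
    · rintro ⟨⟨z, hz, rfl⟩, hq⟩
      exact ⟨z, ⟨hz, hq⟩, rfl⟩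
    · rintro ⟨z, ⟨hz, hq⟩, rfl⟩
      exact ⟨⟨z, hz, rfl⟩, hq⟩
  have hmain := isLocallyZeroSetAt_snd_image n hGloc hV (hsnd.trans_subset hFA) hGproper
  rw [hsnd] at hmain
  refine ⟨hFA, fun z hzV hz => mem_image_of_mem_closure_of_proper hFA' hV hproper hzV hz,
    fun a ha => ?_⟩
  obtain ⟨W, hW, haW, k, f, hf, hAW⟩ := hmain a ha
  refine ⟨W ∩ V, hW.inter hV, ⟨haW, hFA ha⟩, inter_subset_right, k, f,
    fun i => (hf i).mono inter_subset_left, ?_⟩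
  rw [← inter_assoc, hAW]
  ext z
  simp only [mem_inter_iff, mem_ofPred_eq]
  tauto
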